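/- (Conservation law ω₃ of the tangent equation.) Let (u,v) be a smooth solution of the Pavlov–Mikhalev system on ℝ³ and let (p,q) be a smooth solution of the tangent system. Set X₃ = ((3/2)·u_x² − y·u_xt)·p_x + (y·u_xx + 1/2)·p_t − u_xy·p + u_x·p_y − (1/2)·y·p_yt and Y₃ = (u_x·u_xy − u_y·u_xx − u_xt)·p + (u_x·u_y − (1/2)·y·u_yt)·p_x + (1/2)·(u_x² − y·u_xt)·p_y + (y·u_xy + u_x)·p_t − (1/2)·y·(u_y·p_xt − u_x·p_yt + p_tt). Then ∂_y(X₃) = ∂_x(Y₃) at every point of ℝ³. -/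

import Mathlib

noncomputable section

/-- Partial derivative with respect to the first coordinate `t`. -/
def Dt (f : ℝ → ℝ → ℝ → ℝ) : ℝ → ℝ → ℝ → ℝ := fun t x y => deriv (fun s => f s x y) t

/-- Partial derivative with respect to the second coordinate `x`. -/
def Dx (f : ℝ → ℝ → ℝ → ℝ) : ℝ → ℝ → ℝ → ℝ := fun t x y => deriv (fun s => f t s y) x

/-- Partial derivative with respect to the third coordinate `y`. -/
def Dy (f : ℝ → ℝ → ℝ → ℝ) : ℝ → ℝ → ℝ → ℝ := fun t x y => deriv (fun s => f t x s) y

/-- `f` is a smooth function on `ℝ³` (given in curried form, coordinates `(t, x, y)`). -/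
def Smooth3 (f : ℝ → ℝ → ℝ → ℝ) : Prop :=
  ContDiff ℝ (⊤ : ℕ∞) (fun p : ℝ × ℝ × ℝ => f p.1 p.2.1 p.2.2)

/-- The Pavlov–Mikhalev equation `u_yy = u_xt − u_x·u_xy + u_y·u_xx`. -/
def PMu (u : ℝ → ℝ → ℝ → ℝ) : Prop :=
  ∀ t x y : ℝ, Dy (Dy u) t x y =
    Dt (Dx u) t x y - Dx u t x y * Dy (Dx u) t x y + Dy u t x y * Dx (Dx u) t x y

/-- The second equation of the two-component Pavlov–Mikhalev system:
`v_yy = v_xt − u_x·v_xy − 2·v_y·u_xx + 2·v_x·u_xy + u_y·v_xx`. -/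
def PMv (u v : ℝ → ℝ → ℝ → ℝ) : Prop :=
  ∀ t x y : ℝ, Dy (Dy v) t x y =
    Dt (Dx v) t x y - Dx u t x y * Dy (Dx v) t x y
      - 2 * Dy v t x y * Dx (Dx u) t x y + 2 * Dx v t x y * Dy (Dx u) t x y
      + Dy u t x y * Dx (Dx v) t x y

/-- First equation of the linearized system applied to `A = φ^u`:
`φ^u_yy = φ^u_xt + u_xx·φ^u_y + u_y·φ^u_xx − u_x·φ^u_xy − u_xy·φ^u_x`. -/
def LinU (u A : ℝ → ℝ → ℝ → ℝ) : Prop :=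
  ∀ t x y : ℝ, Dy (Dy A) t x y =
    Dt (Dx A) t x y + Dx (Dx u) t x y * Dy A t x y + Dy u t x y * Dx (Dx A) t x y
      - Dx u t x y * Dy (Dx A) t x y - Dy (Dx u) t x y * Dx A t x y

/-- Second equation of the linearized system applied to `(A, B) = (φ^u, φ^v)`. -/
def LinV (u v A B : ℝ → ℝ → ℝ → ℝ) : Prop :=
  ∀ t x y : ℝ, Dy (Dy B) t x y =
    2 * Dx v t x y * Dy (Dx A) t x y - Dy (Dx v) t x y * Dx A t x y
      + Dx (Dx v) t x y * Dy A t x y - 2 * Dy v t x y * Dx (Dx A) t x y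
      + Dt (Dx B) t x y + 2 * Dy (Dx u) t x y * Dx B t x y
      - 2 * Dx (Dx u) t x y * Dy B t x y + Dy u t x y * Dx (Dx B) t x y
      - Dx u t x y * Dy (Dx B) t x y

/-- `(A,B)` is a symmetry generating function of the Pavlov–Mikhalev system over `(u,v)`. -/
def IsSymmetry (u v A B : ℝ → ℝ → ℝ → ℝ) : Prop := LinU u A ∧ LinV u v A B

/-- First equation of the tangent system over a solution `(u,v)`:
`p_yy = u_y·p_xx − u_xy·p_x − u_x·p_xy + u_xx·p_y + p_xt`. -/
def TanP (u p : ℝ → ℝ → ℝ → ℝ) : Prop :=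
  ∀ t x y : ℝ, Dy (Dy p) t x y =
    Dy u t x y * Dx (Dx p) t x y - Dy (Dx u) t x y * Dx p t x y
      - Dx u t x y * Dy (Dx p) t x y + Dx (Dx u) t x y * Dy p t x y + Dt (Dx p) t x y

/-- Second equation of the tangent system over a solution `(u,v)`:
`q_yy = 2·v_x·p_xy + v_xx·p_y − v_xy·p_x − 2·v_y·p_xx + 2·u_xy·q_x + u_y·q_xx
  − u_x·q_xy − 2·u_xx·q_y + q_xt`. -/
def TanQ (u v p q : ℝ → ℝ → ℝ → ℝ) : Prop :=
  ∀ t x y : ℝ, Dy (Dy q) t x y =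
    2 * Dx v t x y * Dy (Dx p) t x y + Dx (Dx v) t x y * Dy p t x y
      - Dy (Dx v) t x y * Dx p t x y - 2 * Dy v t x y * Dx (Dx p) t x y
      + 2 * Dy (Dx u) t x y * Dx q t x y + Dy u t x y * Dx (Dx q) t x y
      - Dx u t x y * Dy (Dx q) t x y - 2 * Dx (Dx u) t x y * Dy q t x y
      + Dt (Dx q) t x y

/-- The uncurried form of a function of `(t, x, y)`. -/
def uncurry3 (f : ℝ → ℝ → ℝ → ℝ) : ℝ × ℝ × ℝ → ℝ := fun p => f p.1 p.2.1 p.2.2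

theorem Smooth3.contDiff {f : ℝ → ℝ → ℝ → ℝ} (hf : Smooth3 f) :
    ContDiff ℝ (⊤ : ℕ∞) (uncurry3 f) := hf

theorem Smooth3.hasFDerivAt {f : ℝ → ℝ → ℝ → ℝ} (hf : Smooth3 f) (p : ℝ × ℝ × ℝ) :
    HasFDerivAt (uncurry3 f) (fderiv ℝ (uncurry3 f) p) p :=
  (hf.contDiff.differentiable (by simp) p).hasFDerivAt

theorem Smooth3.hasDerivAt_t_fderiv {f : ℝ → ℝ → ℝ → ℝ} (hf : Smooth3 f) (t x y : ℝ) :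
    HasDerivAt (fun s => f s x y) (fderiv ℝ (uncurry3 f) (t, x, y) (1, 0, 0)) t :=
  HasFDerivAt.comp_hasDerivAt (l := uncurry3 f) (f := fun s => (s, x, y)) t
    (hf.hasFDerivAt (t, x, y))
    ((hasDerivAt_id t).prodMk ((hasDerivAt_const t x).prodMk (hasDerivAt_const t y)))

theorem Smooth3.hasDerivAt_x_fderiv {f : ℝ → ℝ → ℝ → ℝ} (hf : Smooth3 f) (t x y : ℝ) :
    HasDerivAt (fun s => f t s y) (fderiv ℝ (uncurry3 f) (t, x, y) (0, 1, 0)) x :=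
  HasFDerivAt.comp_hasDerivAt (l := uncurry3 f) (f := fun s => (t, s, y)) x
    (hf.hasFDerivAt (t, x, y))
    ((hasDerivAt_const x t).prodMk ((hasDerivAt_id x).prodMk (hasDerivAt_const x y)))

theorem Smooth3.hasDerivAt_y_fderiv {f : ℝ → ℝ → ℝ → ℝ} (hf : Smooth3 f) (t x y : ℝ) :
    HasDerivAt (fun s => f t x s) (fderiv ℝ (uncurry3 f) (t, x, y) (0, 0, 1)) y :=
  HasFDerivAt.comp_hasDerivAt (l := uncurry3 f) (f := fun s => (t, x, s)) y
    (hf.hasFDerivAt (t, x, y))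
    ((hasDerivAt_const y t).prodMk ((hasDerivAt_const y x).prodMk (hasDerivAt_id y)))

theorem ContDiff.fderiv_apply_const {E : Type*} [NormedAddCommGroup E] [NormedSpace ℝ E]
    {F : E → ℝ} (hF : ContDiff ℝ (⊤ : ℕ∞) F) (v : E) :
    ContDiff ℝ (⊤ : ℕ∞) (fun p => fderiv ℝ F p v) :=
  (hF.fderiv_right (m := (⊤ : ℕ∞)) (by simp)).clm_apply contDiff_const

theorem ContDiff.fderiv_fderiv_comm {E : Type*} [NormedAddCommGroup E] [NormedSpace ℝ E]
    {F : E → ℝ} (hF : ContDiff ℝ (⊤ : ℕ∞) F) (v w p : E) :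
    fderiv ℝ (fun q => fderiv ℝ F q v) p w = fderiv ℝ (fun q => fderiv ℝ F q w) p v := by
  have hd : DifferentiableAt ℝ (fderiv ℝ F) p :=
    (hF.fderiv_right (m := (⊤ : ℕ∞)) (by simp)).differentiable (by simp) p
  have hs : IsSymmSndFDerivAt ℝ F p :=
    hF.contDiffAt.isSymmSndFDerivAt (by
      rw [minSmoothness_of_isRCLikeNormedField]
      exact WithTop.coe_le_coe.2 le_top)
  rw [fderiv_clm_apply hd (differentiableAt_const v), fderiv_clm_apply hd (differentiableAt_const w)]
  simpa using hs.eq w v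

theorem Smooth3.uncurry3_Dt {f : ℝ → ℝ → ℝ → ℝ} (hf : Smooth3 f) :
    uncurry3 (Dt f) = fun p => fderiv ℝ (uncurry3 f) p (1, 0, 0) :=
  funext fun p => (hf.hasDerivAt_t_fderiv p.1 p.2.1 p.2.2).deriv

theorem Smooth3.Dt {f : ℝ → ℝ → ℝ → ℝ} (hf : Smooth3 f) : Smooth3 (Dt f) := by
  change ContDiff ℝ (⊤ : ℕ∞) (uncurry3 (_root_.Dt f))
  rw [hf.uncurry3_Dt]
  exact hf.contDiff.fderiv_apply_const _

theorem Smooth3.hasDerivAt_t {f : ℝ → ℝ → ℝ → ℝ} (hf : Smooth3 f) (t x y : ℝ) :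
    HasDerivAt (fun s => f s x y) (_root_.Dt f t x y) t :=
  (hf.hasDerivAt_t_fderiv t x y).differentiableAt.hasDerivAt

theorem Smooth3.uncurry3_Dx {f : ℝ → ℝ → ℝ → ℝ} (hf : Smooth3 f) :
    uncurry3 (Dx f) = fun p => fderiv ℝ (uncurry3 f) p (0, 1, 0) :=
  funext fun p => (hf.hasDerivAt_x_fderiv p.1 p.2.1 p.2.2).deriv

theorem Smooth3.Dx {f : ℝ → ℝ → ℝ → ℝ} (hf : Smooth3 f) : Smooth3 (Dx f) := by
  change ContDiff ℝ (⊤ : ℕ∞) (uncurry3 (_root_.Dx f))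
  rw [hf.uncurry3_Dx]
  exact hf.contDiff.fderiv_apply_const _

theorem Smooth3.hasDerivAt_x {f : ℝ → ℝ → ℝ → ℝ} (hf : Smooth3 f) (t x y : ℝ) :
    HasDerivAt (fun s => f t s y) (_root_.Dx f t x y) x :=
  (hf.hasDerivAt_x_fderiv t x y).differentiableAt.hasDerivAt

theorem Smooth3.uncurry3_Dy {f : ℝ → ℝ → ℝ → ℝ} (hf : Smooth3 f) :
    uncurry3 (Dy f) = fun p => fderiv ℝ (uncurry3 f) p (0, 0, 1) :=
  funext fun p => (hf.hasDerivAt_y_fderiv p.1 p.2.1 p.2.2).deriv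

theorem Smooth3.Dy {f : ℝ → ℝ → ℝ → ℝ} (hf : Smooth3 f) : Smooth3 (Dy f) := by
  change ContDiff ℝ (⊤ : ℕ∞) (uncurry3 (_root_.Dy f))
  rw [hf.uncurry3_Dy]
  exact hf.contDiff.fderiv_apply_const _

theorem Smooth3.hasDerivAt_y {f : ℝ → ℝ → ℝ → ℝ} (hf : Smooth3 f) (t x y : ℝ) :
    HasDerivAt (fun s => f t x s) (_root_.Dy f t x y) y :=
  (hf.hasDerivAt_y_fderiv t x y).differentiableAt.hasDerivAt

theorem Smooth3.Dx_Dy {f : ℝ → ℝ → ℝ → ℝ} (hf : Smooth3 f) :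
    _root_.Dx (_root_.Dy f) = _root_.Dy (_root_.Dx f) := by
  funext t x y
  rw [(hf.Dy.hasDerivAt_x t x y).unique (hf.Dy.hasDerivAt_x_fderiv t x y),
    (hf.Dx.hasDerivAt_y t x y).unique (hf.Dx.hasDerivAt_y_fderiv t x y),
    hf.uncurry3_Dx, hf.uncurry3_Dy]
  exact hf.contDiff.fderiv_fderiv_comm _ _ _

theorem Smooth3.Dx_Dt {f : ℝ → ℝ → ℝ → ℝ} (hf : Smooth3 f) :
    _root_.Dx (_root_.Dt f) = _root_.Dt (_root_.Dx f) := by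
  funext t x y
  rw [(hf.Dt.hasDerivAt_x t x y).unique (hf.Dt.hasDerivAt_x_fderiv t x y),
    (hf.Dx.hasDerivAt_t t x y).unique (hf.Dx.hasDerivAt_t_fderiv t x y),
    hf.uncurry3_Dx, hf.uncurry3_Dt]
  exact hf.contDiff.fderiv_fderiv_comm _ _ _

theorem Smooth3.Dy_Dt {f : ℝ → ℝ → ℝ → ℝ} (hf : Smooth3 f) :
    _root_.Dy (_root_.Dt f) = _root_.Dt (_root_.Dy f) := by
  funext t x y
  rw [(hf.Dt.hasDerivAt_y t x y).unique (hf.Dt.hasDerivAt_y_fderiv t x y),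
    (hf.Dy.hasDerivAt_t t x y).unique (hf.Dy.hasDerivAt_t_fderiv t x y),
    hf.uncurry3_Dy, hf.uncurry3_Dt]
  exact hf.contDiff.fderiv_fderiv_comm _ _ _

theorem conservation_law_omega3 (u v p q : ℝ → ℝ → ℝ → ℝ)
    (hu : Smooth3 u) (hv : Smooth3 v) (hp : Smooth3 p) (hq : Smooth3 q)
    (hPMu : PMu u) (hPMv : PMv u v) (hTanP : TanP u p) (hTanQ : TanQ u v p q)
    (X₃ Y₃ : ℝ → ℝ → ℝ → ℝ)
    (hX : X₃ = fun t x y => ((3/2) * (Dx u t x y)^2 - y * Dt (Dx u) t x y) * Dx p t x y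
      + (y * Dx (Dx u) t x y + 1/2) * Dt p t x y - Dy (Dx u) t x y * p t x y
      + Dx u t x y * Dy p t x y - (1/2) * y * Dt (Dy p) t x y)
    (hY : Y₃ = fun t x y => (Dx u t x y * Dy (Dx u) t x y - Dy u t x y * Dx (Dx u) t x y
        - Dt (Dx u) t x y) * p t x y
      + (Dx u t x y * Dy u t x y - (1/2) * y * Dt (Dy u) t x y) * Dx p t x y
      + (1/2) * ((Dx u t x y)^2 - y * Dt (Dx u) t x y) * Dy p t x y
      + (y * Dy (Dx u) t x y + Dx u t x y) * Dt p t x y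
      - (1/2) * y * (Dy u t x y * Dt (Dx p) t x y - Dx u t x y * Dt (Dy p) t x y
        + Dt (Dt p) t x y)) :
    ∀ t x y : ℝ, Dy X₃ t x y = Dx Y₃ t x y := by
  intro t x y
  have hux := hu.Dx
  have huy := hu.Dy
  have hpx := hp.Dx
  have hpy := hp.Dy
  have hpt := hp.Dt
  have hF : Dx (Dy (Dy u)) t x y = _ :=
    (congrArg (fun g => Dx g t x y) (funext fun t => funext fun x => funext fun y => hPMu t x y)).trans
      (((hux.Dt.hasDerivAt_x t x y).sub
        ((hux.hasDerivAt_x t x y).mul (hux.Dy.hasDerivAt_x t x y))).add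
        ((huy.hasDerivAt_x t x y).mul (hux.Dx.hasDerivAt_x t x y))).deriv
  have hG : Dt (Dy (Dy p)) t x y = _ :=
    (congrArg (fun g => Dt g t x y) (funext fun t => funext fun x => funext fun y => hTanP t x y)).trans
      ((((((huy.hasDerivAt_t t x y).mul (hpx.Dx.hasDerivAt_t t x y)).sub
        ((hux.Dy.hasDerivAt_t t x y).mul (hpx.hasDerivAt_t t x y))).sub
        ((hux.hasDerivAt_t t x y).mul (hpx.Dy.hasDerivAt_t t x y))).add
        ((hux.Dx.hasDerivAt_t t x y).mul (hpy.hasDerivAt_t t x y))).add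
        (hpx.Dt.hasDerivAt_t t x y)).deriv
  have hXy : Dy X₃ t x y = _ := (congrArg (fun g => Dy g t x y) hX).trans
    ((((((((hux.hasDerivAt_y t x y).pow 2).const_mul (3/2)).sub
      ((hasDerivAt_id' y).mul (hux.Dt.hasDerivAt_y t x y))).mul (hpx.hasDerivAt_y t x y)).add
      ((((hasDerivAt_id' y).mul (hux.Dx.hasDerivAt_y t x y)).add_const (1/2)).mul
        (hpt.hasDerivAt_y t x y))).sub
      ((hux.Dy.hasDerivAt_y t x y).mul (hp.hasDerivAt_y t x y))).add
      ((hux.hasDerivAt_y t x y).mul (hpy.hasDerivAt_y t x y)) |>.sub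
      (((hasDerivAt_id' y).const_mul (1/2)).mul (hpy.Dt.hasDerivAt_y t x y))).deriv
  have hYx : Dx Y₃ t x y = _ := (congrArg (fun g => Dx g t x y) hY).trans
    (((((((hux.hasDerivAt_x t x y).mul (hux.Dy.hasDerivAt_x t x y)).sub
      ((huy.hasDerivAt_x t x y).mul (hux.Dx.hasDerivAt_x t x y))).sub
      (hux.Dt.hasDerivAt_x t x y)).mul (hp.hasDerivAt_x t x y)).add
      ((((hux.hasDerivAt_x t x y).mul (huy.hasDerivAt_x t x y)).sub
        ((huy.Dt.hasDerivAt_x t x y).const_mul ((1/2) * y))).mul (hpx.hasDerivAt_x t x y))).add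
      (((((hux.hasDerivAt_x t x y).pow 2).sub
        ((hux.Dt.hasDerivAt_x t x y).const_mul y)).const_mul (1/2)).mul
        (hpy.hasDerivAt_x t x y)) |>.add
      ((((hux.Dy.hasDerivAt_x t x y).const_mul y).add (hux.hasDerivAt_x t x y)).mul
        (hpt.hasDerivAt_x t x y)) |>.sub
      (((((huy.hasDerivAt_x t x y).mul (hpx.Dt.hasDerivAt_x t x y)).sub
        ((hux.hasDerivAt_x t x y).mul (hpy.Dt.hasDerivAt_x t x y))).add
        (hpt.Dt.hasDerivAt_x t x y)).const_mul ((1/2) * y))).deriv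
  have hP := hTanP t x y
  rw [hXy, hYx]
  simp only [Pi.mul_apply, Pi.sub_apply, Pi.add_apply, Pi.pow_apply,
    hu.Dx_Dy, hux.Dx_Dy, hux.Dx_Dt, hux.Dy_Dt, huy.Dx_Dy, huy.Dx_Dt,
    hp.Dx_Dy, hp.Dx_Dt, hp.Dy_Dt, hpx.Dx_Dt, hpy.Dx_Dt, hpy.Dy_Dt, hpt.Dx_Dt] at hF hG ⊢
  linear_combination Dx u t x y * hP - (1/2) * y * hG - p t x y * hF
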